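/- arXiv:1303.1202 — 6 statements merged into one kernel-verified Lean document; each statement's English description precedes it below -/
import Mathlib

section
/- Let G be a finite simple graph on vertex set {1,…,N} with edge set E of cardinality |E|, let K be a positive even integer, let J = K·A(G) be K times the adjacency matrix of G, and let y be a real number with 0 < |y| < 1. Then N(G)·|y|^{K·(|E| - M(G))} ≤ Z(J,y) ≤ N(G)·|y|^{K·(|E| - M(G))} + 2^N·|y|^{K·(1 + |E| - M(G))}. -/
open Finset

/-- The Ising partition function `Z(J,y)`. -/
noncomputable def IsingZ (N : ℕ) (J : Fin N → Fin N → ℤ) (y : ℝ) : ℝ :=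
  ∑ σ : Fin N → ({-1, 1} : Finset ℤ),
    y ^ (∑ p ∈ Finset.univ.filter (fun p : Fin N × Fin N => p.1 < p.2),
      J p.1 p.2 * (if (σ p.1 : ℤ) = (σ p.2 : ℤ) then 1 else 0))

/-- The size of the cut determined by the spin configuration `σ`: the number of
edges `{i,j}` of `G` with `σ_i ≠ σ_j`. -/
def cutSize (N : ℕ) (G : SimpleGraph (Fin N)) [DecidableRel G.Adj]
    (σ : Fin N → ({-1, 1} : Finset ℤ)) : ℕ :=
  (Finset.univ.filter (fun p : Fin N × Fin N =>
    p.1 < p.2 ∧ G.Adj p.1 p.2 ∧ (σ p.1 : ℤ) ≠ (σ p.2 : ℤ))).card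

/-- The number of edges `|E|` of `G`. -/
def edgeCount (N : ℕ) (G : SimpleGraph (Fin N)) [DecidableRel G.Adj] : ℕ :=
  (Finset.univ.filter (fun p : Fin N × Fin N => p.1 < p.2 ∧ G.Adj p.1 p.2)).card

/-- The maximum cut size `M(G)`. -/
def maxCut (N : ℕ) (G : SimpleGraph (Fin N)) [DecidableRel G.Adj] : ℕ :=
  Finset.univ.sup (fun σ : Fin N → ({-1, 1} : Finset ℤ) => cutSize N G σ)

/-- The number `N(G)` of spin configurations realizing a maximum cut. -/
def numMaxCut (N : ℕ) (G : SimpleGraph (Fin N)) [DecidableRel G.Adj] : ℕ :=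
  (Finset.univ.filter (fun σ : Fin N → ({-1, 1} : Finset ℤ) =>
    cutSize N G σ = maxCut N G)).card

/-- The monochromatic edges are exactly the edges outside the cut. -/
theorem sum_mul_adj_eq (N : ℕ) (G : SimpleGraph (Fin N)) [DecidableRel G.Adj]
    (K : ℤ) (J : Fin N → Fin N → ℤ) (hJ : ∀ i j, J i j = K * (if G.Adj i j then 1 else 0))
    (σ : Fin N → ({-1, 1} : Finset ℤ)) :
    (∑ p ∈ Finset.univ.filter (fun p : Fin N × Fin N => p.1 < p.2),
      J p.1 p.2 * (if (σ p.1 : ℤ) = (σ p.2 : ℤ) then 1 else 0))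
      = K * ((edgeCount N G : ℤ) - (cutSize N G σ : ℤ)) := by
  unfold edgeCount cutSize
  rw [Finset.card_filter, Finset.card_filter, Finset.sum_filter]
  push_cast
  rw [← Finset.sum_sub_distrib, Finset.mul_sum]
  refine Finset.sum_congr rfl fun p _ => ?_
  rw [hJ]
  by_cases h₁ : p.1 < p.2 <;> by_cases h₂ : G.Adj p.1 p.2 <;>
    by_cases h₃ : (σ p.1 : ℤ) = (σ p.2 : ℤ) <;> simp [h₁, h₂, h₃]

theorem isingZ_eq_sum_abs_zpow (N : ℕ) (G : SimpleGraph (Fin N)) [DecidableRel G.Adj]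
    (K : ℤ) (hKeven : Even K)
    (J : Fin N → Fin N → ℤ) (hJ : ∀ i j, J i j = K * (if G.Adj i j then 1 else 0)) (y : ℝ) :
    IsingZ N J y = ∑ σ : Fin N → ({-1, 1} : Finset ℤ),
      |y| ^ (K * ((edgeCount N G : ℤ) - (cutSize N G σ : ℤ))) := by
  unfold IsingZ
  refine Finset.sum_congr rfl fun σ _ => ?_
  rw [sum_mul_adj_eq N G K J hJ σ, (hKeven.mul_right _).zpow_abs]

theorem cutSize_le_maxCut (N : ℕ) (G : SimpleGraph (Fin N)) [DecidableRel G.Adj]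
    (σ : Fin N → ({-1, 1} : Finset ℤ)) : cutSize N G σ ≤ maxCut N G :=
  Finset.le_sup (f := fun σ => cutSize N G σ) (Finset.mem_univ σ)

/-- `N(G)·|y|^{K(|E|-M(G))} ≤ Z(J,y) ≤ N(G)·|y|^{K(|E|-M(G))} + 2^N·|y|^{K(1+|E|-M(G))}`
for `J = K·A(G)` with `K` a positive even integer and `0 < |y| < 1`. -/
theorem ising_partition_maxcut_bounds (N : ℕ) (hN : 1 ≤ N)
    (G : SimpleGraph (Fin N)) [DecidableRel G.Adj]
    (K : ℤ) (hK : 0 < K) (hKeven : Even K)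
    (J : Fin N → Fin N → ℤ) (hJ : ∀ i j, J i j = K * (if G.Adj i j then 1 else 0))
    (y : ℝ) (hy0 : 0 < |y|) (hy1 : |y| < 1) :
    (numMaxCut N G : ℝ) * |y| ^ (K * ((edgeCount N G : ℤ) - (maxCut N G : ℤ)))
      ≤ IsingZ N J y ∧
    IsingZ N J y ≤
      (numMaxCut N G : ℝ) * |y| ^ (K * ((edgeCount N G : ℤ) - (maxCut N G : ℤ)))
        + 2 ^ N * |y| ^ (K * (1 + (edgeCount N G : ℤ) - (maxCut N G : ℤ))) := by
  rw [isingZ_eq_sum_abs_zpow N G K hKeven J hJ y,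
    ← Finset.sum_filter_add_sum_filter_not Finset.univ
      (fun σ : Fin N → ({-1, 1} : Finset ℤ) => cutSize N G σ = maxCut N G)]
  have hmax : ∑ σ : Fin N → ({-1, 1} : Finset ℤ) with cutSize N G σ = maxCut N G,
      |y| ^ (K * ((edgeCount N G : ℤ) - (cutSize N G σ : ℤ)))
      = (numMaxCut N G : ℝ) * |y| ^ (K * ((edgeCount N G : ℤ) - (maxCut N G : ℤ))) := by
    rw [numMaxCut, ← nsmul_eq_mul]
    refine Finset.sum_eq_card_nsmul fun σ hσ => ?_
    rw [(Finset.mem_filter.mp hσ).2]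
  rw [hmax]
  refine ⟨le_add_of_nonneg_right (Finset.sum_nonneg fun σ _ => by positivity), ?_⟩
  gcongr
  calc ∑ σ : Fin N → ({-1, 1} : Finset ℤ) with ¬ cutSize N G σ = maxCut N G,
        |y| ^ (K * ((edgeCount N G : ℤ) - (cutSize N G σ : ℤ)))
      ≤ ∑ σ : Fin N → ({-1, 1} : Finset ℤ) with ¬ cutSize N G σ = maxCut N G,
        |y| ^ (K * (1 + (edgeCount N G : ℤ) - (maxCut N G : ℤ))) := by
        refine Finset.sum_le_sum fun σ hσ => zpow_le_zpow_right_of_le_one₀ hy0 hy1.le ?_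
        have hne := (Finset.mem_filter.mp hσ).2
        have hle := cutSize_le_maxCut N G σ
        exact mul_le_mul_of_nonneg_left (by omega) hK.le
    _ ≤ ∑ _σ : Fin N → ({-1, 1} : Finset ℤ),
        |y| ^ (K * (1 + (edgeCount N G : ℤ) - (maxCut N G : ℤ))) :=
        Finset.sum_le_sum_of_subset_of_nonneg (Finset.filter_subset _ _)
          fun σ _ _ => by positivity
    _ = 2 ^ N * |y| ^ (K * (1 + (edgeCount N G : ℤ) - (maxCut N G : ℤ))) := by
        simp
end

section
/- Let G be a finite simple graph on vertex set {1,…,N} with edge set E of cardinality |E|, let y be a real number with 0 < |y| < 1, let K be a positive even integer with K ≥ (N+1)·ln 2 / ln(1/|y|), and let J = K·A(G) be K times the adjacency matrix of G. Then N(G) ≤ Z(J,y) · |y|^{-K·(|E| - M(G))} ≤ N(G) + 1/2. -/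
open Finset

/-- Every edge is either cut or monochromatic, so the energy is `K` times the number of
uncut edges. -/
theorem energy_eq (N : ℕ) (G : SimpleGraph (Fin N)) [DecidableRel G.Adj] (K : ℤ)
    (J : Fin N → Fin N → ℤ) (hJ : ∀ i j, J i j = K * (if G.Adj i j then 1 else 0))
    (σ : Fin N → ({-1, 1} : Finset ℤ)) :
    ∑ p ∈ Finset.univ.filter (fun p : Fin N × Fin N => p.1 < p.2),
      J p.1 p.2 * (if (σ p.1 : ℤ) = (σ p.2 : ℤ) then 1 else 0) =
    K * ((edgeCount N G : ℤ) - (cutSize N G σ : ℤ)) := by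
  rw [edgeCount, cutSize, Finset.card_filter, Finset.card_filter, Finset.sum_filter]
  push_cast
  rw [← Finset.sum_sub_distrib, Finset.mul_sum]
  refine Finset.sum_congr rfl fun p _ => ?_
  rw [hJ]
  by_cases h₁ : p.1 < p.2 <;> by_cases h₂ : G.Adj p.1 p.2 <;>
    by_cases h₃ : (σ p.1 : ℤ) = (σ p.2 : ℤ) <;> simp [h₁, h₂, h₃]

/-- The rescaled partition function is a sum of powers of `|y| ^ K`, indexed by the
deficit from the maximum cut. -/
theorem IsingZ_mul_zpow_eq (N : ℕ) (G : SimpleGraph (Fin N)) [DecidableRel G.Adj]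
    (y : ℝ) (hy0 : 0 < |y|) (K : ℤ) (hKeven : Even K)
    (J : Fin N → Fin N → ℤ) (hJ : ∀ i j, J i j = K * (if G.Adj i j then 1 else 0)) :
    IsingZ N J y * |y| ^ (-(K * ((edgeCount N G : ℤ) - (maxCut N G : ℤ)))) =
      ∑ σ : Fin N → ({-1, 1} : Finset ℤ), (|y| ^ K) ^ (maxCut N G - cutSize N G σ) := by
  rw [IsingZ, Finset.sum_mul]
  refine Finset.sum_congr rfl fun σ _ => ?_
  rw [energy_eq N G K J hJ σ, ← (hKeven.mul_right _).zpow_abs y, ← zpow_add₀ hy0.ne',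
    ← zpow_natCast, ← zpow_mul, Nat.cast_sub (cutSize_le_maxCut N G σ)]
  congr 1
  ring

theorem two_pow_mul_zpow_le_half (N : ℕ) (a : ℝ) (ha0 : 0 < a) (ha1 : a < 1) (K : ℤ)
    (hKbig : (N + 1) * Real.log 2 / Real.log (1 / a) ≤ (K : ℝ)) :
    2 ^ N * a ^ K ≤ 1 / 2 := by
  have hlog : 0 < Real.log (1 / a) := Real.log_pos (by rwa [lt_div_iff₀ ha0, one_mul])
  rw [div_le_iff₀ hlog, one_div, Real.log_inv] at hKbig
  have hpos : (0 : ℝ) < 2 ^ N * a ^ K := by positivity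
  rw [← Real.log_le_log_iff hpos (by norm_num), Real.log_mul (by positivity) (by positivity),
    Real.log_pow, Real.log_zpow, one_div, Real.log_inv]
  linarith

theorem card_spin_config (N : ℕ) :
    Fintype.card (Fin N → ({-1, 1} : Finset ℤ)) = 2 ^ N := by
  simp

/-- For `K` a positive even integer with `K ≥ (N+1)·ln 2 / ln(1/|y|)` and
`J = K·A(G)`, the rescaled partition function determines `N(G)`:
`N(G) ≤ Z(J,y)·|y|^{-K(|E|-M(G))} ≤ N(G) + 1/2`. -/
theorem ising_partition_determines_numMaxCut (N : ℕ) (hN : 1 ≤ N)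
    (G : SimpleGraph (Fin N)) [DecidableRel G.Adj]
    (y : ℝ) (hy0 : 0 < |y|) (hy1 : |y| < 1)
    (K : ℤ) (hK : 0 < K) (hKeven : Even K)
    (hKbig : (K : ℝ) ≥ (N + 1) * Real.log 2 / Real.log (1 / |y|))
    (J : Fin N → Fin N → ℤ) (hJ : ∀ i j, J i j = K * (if G.Adj i j then 1 else 0)) :
    (numMaxCut N G : ℝ) ≤
      IsingZ N J y * |y| ^ (-(K * ((edgeCount N G : ℤ) - (maxCut N G : ℤ)))) ∧
    IsingZ N J y * |y| ^ (-(K * ((edgeCount N G : ℤ) - (maxCut N G : ℤ)))) ≤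
      (numMaxCut N G : ℝ) + 1 / 2 := by
  have hq0 : 0 < |y| ^ K := zpow_pos hy0 K
  have hq1 : |y| ^ K ≤ 1 := zpow_le_one₀ hy0 hy1.le hK.le
  have hcount : (numMaxCut N G : ℝ) = ∑ σ : Fin N → ({-1, 1} : Finset ℤ),
      if cutSize N G σ = maxCut N G then (1 : ℝ) else 0 := by
    rw [numMaxCut, Finset.card_filter]
    push_cast
    rfl
  rw [IsingZ_mul_zpow_eq N G y hy0 K hKeven J hJ, hcount]
  constructor
  · refine Finset.sum_le_sum fun σ _ => ?_
    split_ifs with h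
    · simp [h]
    · positivity
  · calc ∑ σ : Fin N → ({-1, 1} : Finset ℤ), (|y| ^ K) ^ (maxCut N G - cutSize N G σ)
        ≤ ∑ σ : Fin N → ({-1, 1} : Finset ℤ),
            ((if cutSize N G σ = maxCut N G then (1 : ℝ) else 0) + |y| ^ K) := by
          refine Finset.sum_le_sum fun σ _ => ?_
          split_ifs with h
          · simp [h, hq0.le]
          · have hlt := lt_of_le_of_ne (cutSize_le_maxCut N G σ) h
            rw [zero_add]
            exact pow_le_of_le_one hq0.le hq1 (Nat.sub_pos_of_lt hlt).ne'
      _ = (∑ σ : Fin N → ({-1, 1} : Finset ℤ),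
            if cutSize N G σ = maxCut N G then (1 : ℝ) else 0) + 2 ^ N * |y| ^ K := by
          rw [Finset.sum_add_distrib, Finset.sum_const, Finset.card_univ, card_spin_config,
            nsmul_eq_mul]
          push_cast
          rfl
      _ ≤ _ := by
          gcongr
          exact two_pow_mul_zpow_le_half N |y| hy0 hy1 K hKbig
end

section
/- Let m ≥ 3 be an odd integer, ω = e^{2πi/m}, and let A be a unital associative ℂ-algebra. Suppose u, v ∈ A satisfy u^m = 1, v^m = 1, and u·v = ω^{-2}·(v·u). Then g(u)·g(v)·g(u) = g(v)·g(u)·g(v), where g(x) = (1/√m)·Σ_{j=0}^{m-1} ω^{j²}·x^j. -/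
open Finset

/-- The Gaussian element `g(u) = (1/√m)·Σ_{j=0}^{m-1} ω^{j²}·u^j` in a unital
associative `ℂ`-algebra. -/
noncomputable def gauss {A : Type*} [Ring A] [Algebra ℂ A] (m : ℕ) (ω : ℂ)
    (u : A) : A :=
  ((1 / Real.sqrt m : ℝ) : ℂ) • ∑ j ∈ Finset.range m, ω ^ (j ^ 2) • u ^ j

namespace GaussBraid

variable {A : Type*} [Ring A] [Algebra ℂ A] {m : ℕ} {ω : ℂ} {u v : A}

/-- The unnormalised Gaussian element `Σ_{j<m} ω^{j²}·u^j`. -/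
noncomputable def gaussSum (m : ℕ) (ω : ℂ) (u : A) : A :=
  ∑ j ∈ Finset.range m, ω ^ (j ^ 2) • u ^ j

lemma gaussSum_shift (hω : ω ^ m = 1) (hu : u ^ m = 1) :
    ∑ j ∈ Finset.range m, ω ^ ((j + 1) ^ 2) • u ^ (j + 1) = gaussSum m ω u := by
  have h := (Finset.sum_range_succ' (fun j => ω ^ (j ^ 2) • u ^ j) m).symm.trans
    (Finset.sum_range_succ _ m)
  have hm : ω ^ (m ^ 2) = 1 := by rw [sq, pow_mul, hω, one_pow]
  simpa [hm, hu, gaussSum] using h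

lemma gaussSum_reflect (hω : ω ^ m = 1) (hu : u ^ m = 1) :
    ∑ j ∈ Finset.range m, ω ^ (j ^ 2) • u ^ (m - j) = gaussSum m ω u := by
  rw [← Finset.sum_range_reflect, ← gaussSum_shift hω hu]
  refine Finset.sum_congr rfl fun i hi => ?_
  obtain ⟨k, rfl⟩ : ∃ k, m = i + 1 + k := Nat.exists_eq_add_of_le (Finset.mem_range.1 hi)
  have hk : i + 1 + k - 1 - i = k := by omega
  have hi' : i + 1 + k - k = i + 1 := by omega
  have hpow : ω ^ (k ^ 2) = ω ^ ((i + 1) ^ 2) := by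
    calc ω ^ (k ^ 2) = ω ^ (k ^ 2) * (ω ^ (i + 1 + k)) ^ (i + 1) := by
          rw [hω, one_pow, mul_one]
      _ = ω ^ ((i + 1) ^ 2) * (ω ^ (i + 1 + k)) ^ k := by ring
      _ = ω ^ ((i + 1) ^ 2) := by rw [hω, one_pow, mul_one]
  rw [hk, hi', hpow]

lemma mul_pow_of_skew (h : v * u = ω ^ 2 • (u * v)) (a : ℕ) :
    v * u ^ a = ω ^ (2 * a) • (u ^ a * v) := by
  induction a with
  | zero => simp
  | succ a ih =>
    rw [pow_succ, ← mul_assoc, ih, smul_mul_assoc, mul_assoc, h, mul_smul_comm, smul_smul,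
      ← pow_add, mul_assoc, mul_add]

lemma pow_mul_of_skew (h : v * u = ω ^ 2 • (u * v)) (b : ℕ) :
    v ^ b * u = ω ^ (2 * b) • (u * v ^ b) := by
  induction b with
  | zero => simp
  | succ b ih =>
    rw [pow_succ', mul_assoc, ih, mul_smul_comm, ← mul_assoc, h, smul_mul_assoc, smul_smul,
      ← pow_add, mul_assoc, mul_add]

lemma smul_mul_gaussSum (hω : ω ^ m = 1) (hu : u ^ m = 1) (h : v * u = ω ^ 2 • (u * v)) :
    ω • (u * (v * gaussSum m ω u)) = gaussSum m ω u * v := by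
  conv_rhs => rw [← gaussSum_shift hω hu]
  rw [gaussSum, Finset.mul_sum, Finset.mul_sum, Finset.smul_sum, Finset.sum_mul]
  refine Finset.sum_congr rfl fun a _ => ?_
  rw [mul_smul_comm, mul_pow_of_skew h, mul_smul_comm, mul_smul_comm, smul_smul, smul_smul,
    smul_mul_assoc, pow_succ' u, mul_assoc u]
  congr 1
  ring

lemma smul_gaussSum_mul (hω : ω ^ m = 1) (hv : v ^ m = 1) (h : v * u = ω ^ 2 • (u * v)) :
    ω • (gaussSum m ω v * (u * v)) = u * gaussSum m ω v := by
  conv_rhs => rw [← gaussSum_shift hω hv]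
  rw [gaussSum, Finset.sum_mul, Finset.smul_sum, Finset.mul_sum]
  refine Finset.sum_congr rfl fun b _ => ?_
  rw [smul_mul_assoc, ← mul_assoc, pow_mul_of_skew h, smul_mul_assoc, smul_smul, smul_smul,
    mul_smul_comm, mul_assoc u, ← pow_succ v]
  congr 1
  ring

lemma commute_gaussSum (m : ℕ) (ω : ℂ) (u : A) : Commute u (gaussSum m ω u) :=
  Commute.sum_right _ _ _ fun j _ => ((Commute.refl u).pow_right j).smul_right _

/-- Right multiplication by `u` turns into left multiplication by `v⁻¹` across `g(u)·g(v)`. -/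
lemma mul_gaussSum_mul_gaussSum_mul (hm : m ≠ 0) (hω : ω ^ m = 1) (hu : u ^ m = 1)
    (hv : v ^ m = 1) (h : v * u = ω ^ 2 • (u * v)) :
    v * (gaussSum m ω u * gaussSum m ω v) * u = gaussSum m ω u * gaussSum m ω v := by
  have hω0 : ω ≠ 0 := by
    rintro rfl
    simp [hm] at hω
  have hunit : IsUnit u := IsUnit.of_pow_eq_one hu hm
  apply hunit.mul_left_cancel
  apply smul_right_injective A hω0
  change ω • (u * _) = ω • (u * _)
  calc ω • (u * (v * (gaussSum m ω u * gaussSum m ω v) * u))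
      = ω • (u * (v * gaussSum m ω u)) * (gaussSum m ω v * u) := by
        simp only [smul_mul_assoc, mul_assoc]
    _ = gaussSum m ω u * (v * gaussSum m ω v) * u := by
        rw [smul_mul_gaussSum hω hu h]; simp only [mul_assoc]
    _ = gaussSum m ω u * (gaussSum m ω v * (v * u)) := by
        rw [(commute_gaussSum m ω v).eq]; simp only [mul_assoc]
    _ = ω • (gaussSum m ω u * ω • (gaussSum m ω v * (u * v))) := by
        rw [h, mul_smul_comm, mul_smul_comm, mul_smul_comm, smul_smul, sq]
    _ = ω • (gaussSum m ω u * u * gaussSum m ω v) := by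
        rw [smul_gaussSum_mul hω hv h, mul_assoc]
    _ = ω • (u * (gaussSum m ω u * gaussSum m ω v)) := by
        rw [← (commute_gaussSum m ω u).eq, mul_assoc]

lemma mul_pow_eq_pow_sub_mul {M : Type*} [Monoid M] {u v x : M} (hv : v ^ m = 1)
    (hx : v * x * u = x) {j : ℕ} (hj : j ≤ m) : x * u ^ j = v ^ (m - j) * x := by
  have key : v ^ j * x * u ^ j = x := by
    clear hj
    induction j with
    | zero => simp
    | succ j ih =>
      calc v ^ (j + 1) * x * u ^ (j + 1) = v ^ j * (v * x * u) * u ^ j := by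
            rw [pow_succ, pow_succ']; simp only [mul_assoc]
        _ = x := by rw [hx, ih]
  calc x * u ^ j = v ^ (m - j) * v ^ j * x * u ^ j := by
        rw [← pow_add, Nat.sub_add_cancel hj, hv, one_mul]
    _ = v ^ (m - j) * (v ^ j * x * u ^ j) := by simp only [mul_assoc]
    _ = v ^ (m - j) * x := by rw [key]

lemma gaussSum_braid (hm : m ≠ 0) (hω : ω ^ m = 1) (hu : u ^ m = 1) (hv : v ^ m = 1)
    (h : v * u = ω ^ 2 • (u * v)) :
    gaussSum m ω u * gaussSum m ω v * gaussSum m ω u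
      = gaussSum m ω v * gaussSum m ω u * gaussSum m ω v := by
  have hx := mul_gaussSum_mul_gaussSum_mul hm hω hu hv h
  rw [mul_assoc (gaussSum m ω v)]
  generalize gaussSum m ω u * gaussSum m ω v = x at hx ⊢
  rw [← gaussSum_reflect hω hv, gaussSum, Finset.mul_sum, Finset.sum_mul]
  refine Finset.sum_congr rfl fun j hj => ?_
  rw [mul_smul_comm, smul_mul_assoc, mul_pow_eq_pow_sub_mul hv hx (Finset.mem_range.1 hj).le]

end GaussBraid

/-- The braid relation for the Gaussian elements: if `u^m = v^m = 1` and
`u·v = ω^{-2}·(v·u)` with `ω = e^{2πi/m}`, `m ≥ 3` odd, then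
`g(u)·g(v)·g(u) = g(v)·g(u)·g(v)`. -/
theorem gauss_braid_relation (m : ℕ) (hm : 3 ≤ m) (hodd : Odd m)
    {A : Type*} [Ring A] [Algebra ℂ A]
    (ω : ℂ) (hω : ω = Complex.exp (2 * (Real.pi : ℂ) * Complex.I / (m : ℂ)))
    (u v : A) (hu : u ^ m = 1) (hv : v ^ m = 1)
    (huv : u * v = (ω ^ (-2 : ℤ)) • (v * u)) :
    gauss m ω u * gauss m ω v * gauss m ω u
      = gauss m ω v * gauss m ω u * gauss m ω v := by
  have hm0 : m ≠ 0 := by omega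
  have hωm : ω ^ m = 1 := hω ▸ (Complex.isPrimitiveRoot_exp m hm0).pow_eq_one
  have hω0 : ω ≠ 0 := hω ▸ Complex.exp_ne_zero _
  have hvu : v * u = ω ^ 2 • (u * v) := by
    rw [huv, smul_smul, zpow_neg, zpow_ofNat, mul_inv_cancel₀ (pow_ne_zero 2 hω0), one_smul]
  have hbraid := GaussBraid.gaussSum_braid hm0 hωm hu hv hvu
  unfold GaussBraid.gaussSum at hbraid
  simp only [gauss, smul_mul_assoc, mul_smul_comm, hbraid]
end

section
/- Let m ≥ 3 be an odd integer, ω = e^{2πi/m}, and let A be a unital associative ℂ-algebra. Suppose u ∈ A satisfies u^m = 1. Then ((1/√m)·Σ_{j=0}^{m-1} ω^{j²}·u^j) · ((1/√m)·Σ_{j=0}^{m-1} ω^{-j²}·u^{m-j}) = 1. In particular the Gaussian element g(u) = (1/√m)·Σ_{j=0}^{m-1} ω^{j²}·u^j is invertible, with inverse (1/√m)·Σ_{j=0}^{m-1} ω^{-j²}·u^{m-j}. -/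
open Finset

/-- The quadratic exponential sums of a primitive additive character `ψ` and of its inverse, twisted
by an algebra-valued additive character `v` and its inverse, multiply to the cardinality. -/
lemma sum_quadratic_addChar_mul_sum_inv {R A K : Type*} [CommRing R] [Fintype R]
    [CommRing K] [IsDomain K] [Ring A] [Algebra K A] {ψ : AddChar R K} (hψ : ψ.IsPrimitive)
    (h2 : IsUnit (2 : R)) (v : AddChar R A) :
    (∑ a, ψ (a ^ 2) • v a) * ∑ b, ψ (-b ^ 2) • v (-b) = (Fintype.card R : A) := by
  classical
  calc (∑ a, ψ (a ^ 2) • v a) * ∑ b, ψ (-b ^ 2) • v (-b)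
      = ∑ b, ∑ a, ψ (a ^ 2 - b ^ 2) • v (a - b) := by
        rw [Finset.sum_mul_sum, Finset.sum_comm]
        simp only [smul_mul_smul_comm, ← AddChar.map_add_eq_mul, ← sub_eq_add_neg]
    _ = ∑ b, ∑ d, ψ (b * (2 * d)) • ψ (d ^ 2) • v d := by
        refine Finset.sum_congr rfl fun b _ => ?_
        rw [← Equiv.sum_comp (Equiv.addRight b)]
        refine Finset.sum_congr rfl fun d _ => ?_
        rw [smul_smul, ← AddChar.map_add_eq_mul, Equiv.coe_addRight, add_sub_cancel_right]
        congr 2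
        ring
    _ = (Fintype.card R : A) := by
        rw [Finset.sum_comm]
        simp only [← Finset.sum_smul, AddChar.sum_mulShift _ hψ, h2.mul_right_eq_zero]
        simp [Nat.cast_smul_eq_nsmul]

/-- An additive character of `ZMod n` with values in a not necessarily commutative monoid, given by
an element whose `n`-th power is `1`. -/
def zmodPowChar {M : Type*} [Monoid M] (n : ℕ) [NeZero n] {u : M} (hu : u ^ n = 1) :
    AddChar (ZMod n) M where
  toFun a := u ^ a.val
  map_zero_eq_one' := by simp
  map_add_eq_mul' x y := by rw [ZMod.val_add, ← pow_eq_pow_mod _ hu, pow_add]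

lemma zmodPowChar_natCast {M : Type*} [Monoid M] {n : ℕ} [NeZero n] {u : M} (hu : u ^ n = 1)
    (k : ℕ) : zmodPowChar n hu k = u ^ k := by
  change u ^ (k : ZMod n).val = u ^ k
  rw [ZMod.val_natCast, ← pow_eq_pow_mod _ hu]

lemma sum_zmod_eq_sum_range {M : Type*} [AddCommMonoid M] (n : ℕ) [NeZero n] (f : ZMod n → M) :
    ∑ a, f a = ∑ j ∈ Finset.range n, f j := by
  refine Finset.sum_bij' (fun a _ => a.val) (fun j _ => (j : ZMod n)) ?_ ?_ ?_ ?_ ?_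
  · exact fun a _ => Finset.mem_range.2 a.val_lt
  · simp
  · simp
  · exact fun j hj => ZMod.val_cast_of_lt (Finset.mem_range.1 hj)
  · simp

/-- Unitarity of the Gaussian element: if `u^m = 1` with `ω = e^{2πi/m}`,
`m ≥ 3` odd, then `g(u)·((1/√m)·Σ_j ω^{-j²}·u^{m-j}) = 1`; in particular
`g(u)` is invertible. -/
theorem gauss_mul_inv_eq_one (m : ℕ) (hm : 3 ≤ m) (hodd : Odd m)
    {A : Type*} [Ring A] [Algebra ℂ A]
    (ω : ℂ) (hω : ω = Complex.exp (2 * (Real.pi : ℂ) * Complex.I / (m : ℂ)))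
    (u : A) (hu : u ^ m = 1) :
    gauss m ω u *
      (((1 / Real.sqrt m : ℝ) : ℂ) •
        ∑ j ∈ Finset.range m, ω ^ (-(j : ℤ) ^ 2) • u ^ (m - j)) = 1 ∧
    IsUnit (gauss m ω u) := by
  have : NeZero m := ⟨by omega⟩
  have hprim : IsPrimitiveRoot ω m := hω ▸ Complex.isPrimitiveRoot_exp m (by omega)
  have hψ := AddChar.zmodChar_primitive_of_primitive_root m hprim
  set ψ := AddChar.zmodChar m ((IsPrimitiveRoot.iff_def ω m).mp hprim).left with hψ_def
  set v := zmodPowChar m hu with hv_def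
  have h2 : IsUnit (2 : ZMod m) := by
    exact_mod_cast (ZMod.isUnit_iff_coprime 2 m).2 hodd.coprime_two_left
  have hψ_pow (j : ℕ) : ψ ((j : ZMod m) ^ 2) = ω ^ (j ^ 2) := by
    rw [← Nat.cast_pow, hψ_def, AddChar.zmodChar_apply']
  have hfst : ∑ j ∈ Finset.range m, ω ^ (j ^ 2) • u ^ j = ∑ a, ψ (a ^ 2) • v a := by
    rw [sum_zmod_eq_sum_range]
    simp only [hψ_pow, hv_def, zmodPowChar_natCast]
  have hsnd : ∑ j ∈ Finset.range m, ω ^ (-(j : ℤ) ^ 2) • u ^ (m - j) =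
      ∑ b, ψ (-b ^ 2) • v (-b) := by
    rw [sum_zmod_eq_sum_range]
    refine Finset.sum_congr rfl fun j hj => ?_
    have hneg : -(j : ZMod m) = ((m - j : ℕ) : ZMod m) := by
      simp [Nat.cast_sub (Finset.mem_range.1 hj).le]
    rw [AddChar.map_neg_eq_inv, hψ_pow, hneg, hv_def, zmodPowChar_natCast, zpow_neg]
    norm_cast
  have hscal : ((1 / Real.sqrt m : ℝ) : ℂ) * ((1 / Real.sqrt m : ℝ) : ℂ) * (m : ℂ) = 1 := by
    have hm_pos : (0 : ℝ) < m := by exact_mod_cast (by omega : 0 < m)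
    have hreal : 1 / Real.sqrt m * (1 / Real.sqrt m) * (m : ℝ) = 1 := by
      rw [div_mul_div_comm, Real.mul_self_sqrt hm_pos.le]
      field_simp
    exact_mod_cast hreal
  have hmul : gauss m ω u * (((1 / Real.sqrt m : ℝ) : ℂ) •
      ∑ j ∈ Finset.range m, ω ^ (-(j : ℤ) ^ 2) • u ^ (m - j)) = 1 := by
    rw [gauss, hfst, hsnd, smul_mul_smul_comm, sum_quadratic_addChar_mul_sum_inv hψ h2 v,
      ZMod.card, ← map_natCast (algebraMap ℂ A), Algebra.smul_def, ← map_mul, hscal, map_one]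
  have hcomm : Commute (gauss m ω u) (((1 / Real.sqrt m : ℝ) : ℂ) •
      ∑ j ∈ Finset.range m, ω ^ (-(j : ℤ) ^ 2) • u ^ (m - j)) :=
    ((Commute.sum_left _ _ _ fun i _ => Commute.sum_right _ _ _ fun j _ =>
      (((Commute.refl u).pow_pow i (m - j)).smul_left _).smul_right _).smul_left _).smul_right _
  exact ⟨hmul, isUnit_iff_exists.2 ⟨_, hmul, hcomm.eq ▸ hmul⟩⟩
end

section
/- Let m ≥ 2 be an integer and ω = e^{2πi/m}. On (ℂ^m)^{⊗3}, with each factor indexed by ℤ/m, define U₁ = U ⊗ I and U₂ = I ⊗ U, where U is the matrix on ℂ^m ⊗ ℂ^m given by U(e_i ⊗ e_j) = ω^{i-j}·e_{i+1} ⊗ e_{j+1} (indices mod m). Then U₁·U₂ = ω^{-2}·U₂·U₁. -/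
/-- For an `m`-th root of unity `ω`, the map `x ↦ ω ^ x.val` on `ZMod m` is multiplicative. -/
theorem ZMod.pow_val_add {M : Type*} [Monoid M] {m : ℕ} [NeZero m] {ω : M} (h : ω ^ m = 1)
    (x y : ZMod m) : ω ^ (x + y).val = ω ^ x.val * ω ^ y.val := by
  rw [ZMod.val_add, ← pow_add, ← pow_eq_pow_mod _ h]

/-- On `(ℂ^m)^{⊗3}`, the operators `U₁ = U ⊗ I` and `U₂ = I ⊗ U`, where
`U(e_i ⊗ e_j) = ω^{i-j}·e_{i+1} ⊗ e_{j+1}` (indices mod `m`), satisfy the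
commutation relation `U₁·U₂ = ω^{-2}·U₂·U₁`. -/
theorem localization_commutation (m : ℕ) (hm : 2 ≤ m) [NeZero m]
    (ω : ℂ) (hω : ω = Complex.exp (2 * (Real.pi : ℂ) * Complex.I / (m : ℂ)))
    (U : Matrix (ZMod m × ZMod m) (ZMod m × ZMod m) ℂ)
    (hU : ∀ r c, U r c =
      if r.1 = c.1 + 1 ∧ r.2 = c.2 + 1 then ω ^ ((c.1 - c.2).val) else 0)
    (U₁ U₂ : Matrix (ZMod m × ZMod m × ZMod m) (ZMod m × ZMod m × ZMod m) ℂ)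
    (hU₁ : ∀ r c, U₁ r c =
      U (r.1, r.2.1) (c.1, c.2.1) * (if r.2.2 = c.2.2 then 1 else 0))
    (hU₂ : ∀ r c, U₂ r c =
      (if r.1 = c.1 then 1 else 0) * U (r.2.1, r.2.2) (c.2.1, c.2.2)) :
    U₁ * U₂ = (ω ^ (-2 : ℤ)) • (U₂ * U₁) := by
  have hω_pow : ω ^ m = 1 := hω ▸ (Complex.isPrimitiveRoot_exp m (NeZero.ne m)).pow_eq_one
  have hω_ne : ω ≠ 0 := hω ▸ Complex.exp_ne_zero _
  have val_one : (1 : ZMod m).val = 1 := by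
    have : Fact (1 < m) := ⟨hm⟩
    exact ZMod.val_one m
  have hU₁_col : ∀ r c, U₁ r c =
      if r = (c.1 + 1, c.2.1 + 1, c.2.2) then ω ^ (c.1 - c.2.1).val else 0 := by
    intro r c
    simp only [hU₁, hU, Prod.ext_iff, mul_ite, mul_one, mul_zero]
    split_ifs <;> tauto
  have hU₂_col : ∀ r c, U₂ r c =
      if r = (c.1, c.2.1 + 1, c.2.2 + 1) then ω ^ (c.2.1 - c.2.2).val else 0 := by
    intro r c
    simp only [hU₂, hU, Prod.ext_iff, ite_mul, one_mul, zero_mul]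
    split_ifs <;> tauto
  ext r ⟨a, b, c⟩
  simp only [Matrix.smul_apply, Matrix.mul_apply, hU₁_col, hU₂_col, mul_ite, mul_zero,
    Finset.sum_ite_eq', Finset.mem_univ, if_true, smul_eq_mul, ite_mul, zero_mul]
  split_ifs with hr
  · have h₁ : ω ^ (a - b).val = ω ^ (a - (b + 1)).val * ω := by
      rw [show a - b = a - (b + 1) + 1 by ring, ZMod.pow_val_add hω_pow, val_one, pow_one]
    have h₂ : ω ^ (b + 1 - c).val = ω ^ (b - c).val * ω := by
      rw [show b + 1 - c = b - c + 1 by ring, ZMod.pow_val_add hω_pow, val_one, pow_one]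
    rw [h₁, h₂, zpow_neg, zpow_ofNat]
    field_simp
  · rfl
end

section
/- Let m ≥ 5 be an odd integer and let R_Y be the unitary on (ℂ²)^{⊗3} given by R_Y = (cos(π/m)·I₈ + i·sin(π/m)·(Z ⊗ X ⊗ Z))·NOT. For an integer n ≥ 2, define for each 1 ≤ i ≤ n-1 the operator ρ(σ_i) = I^{⊗(i-1)} ⊗ R_Y ⊗ I^{⊗(n-i-1)} acting on (ℂ²)^{⊗(n+1)}, where R_Y acts on qubits i, i+1, i+2. Then the subgroup of the group of invertible linear maps of (ℂ²)^{⊗(n+1)} generated by {ρ(σ₁),…,ρ(σ_{n-1})} is finite. -/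
/-- The index set for three qubits. -/
abbrev Q3 := Fin 2 × Fin 2 × Fin 2

/-- The Pauli `X` (bit flip) matrix. -/
def pauliX : Matrix (Fin 2) (Fin 2) ℂ := !![0, 1; 1, 0]

/-- The Pauli `Z` matrix `diag(1,-1)`. -/
def pauliZ : Matrix (Fin 2) (Fin 2) ℂ := !![1, 0; 0, -1]

/-- The three-qubit operator `Z ⊗ X ⊗ Z`. -/
def ZXZ : Matrix Q3 Q3 ℂ :=
  fun r c => pauliZ r.1 c.1 * pauliX r.2.1 c.2.1 * pauliZ r.2.2 c.2.2

/-- The XOR-controlled NOT gate on three qubits: it flips `x₂` exactly when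
`x₁ ≠ x₃`. -/
def NOTgate : Matrix Q3 Q3 ℂ :=
  fun r c => if r = (if c.1 = c.2.2 then c else (c.1, 1 - c.2.1, c.2.2))
    then 1 else 0

/-- The generalized `R`-matrix `R_Y = (cos(π/m)·I₈ + i·sin(π/m)·(Z⊗X⊗Z))·NOT`. -/
noncomputable def RY (m : ℕ) : Matrix Q3 Q3 ℂ :=
  ((Real.cos (Real.pi / m) : ℂ) • (1 : Matrix Q3 Q3 ℂ)
    + (Complex.I * (Real.sin (Real.pi / m) : ℂ)) • ZXZ) * NOTgate

/-- The image `ρ(σ_i) = I^{⊗(i-1)} ⊗ R_Y ⊗ I^{⊗(n-i-1)}` of the `i`-th braid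
generator, acting on `(ℂ²)^{⊗(n+1)}` with `R_Y` on qubits `i, i+1, i+2`. -/
noncomputable def rhoGen (m n : ℕ) (i : Fin (n - 1)) :
    Matrix (Fin (n + 1) → Fin 2) (Fin (n + 1) → Fin 2) ℂ :=
  fun r c =>
    RY m (r ⟨i, by have := i.isLt; omega⟩,
          r ⟨(i : ℕ) + 1, by have := i.isLt; omega⟩,
          r ⟨(i : ℕ) + 2, by have := i.isLt; omega⟩)
         (c ⟨i, by have := i.isLt; omega⟩,
          c ⟨(i : ℕ) + 1, by have := i.isLt; omega⟩,
          c ⟨(i : ℕ) + 2, by have := i.isLt; omega⟩) *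
    ∏ k ∈ Finset.univ.filter (fun k : Fin (n + 1) =>
        (k : ℕ) ≠ (i : ℕ) ∧ (k : ℕ) ≠ (i : ℕ) + 1 ∧ (k : ℕ) ≠ (i : ℕ) + 2),
      (if r k = c k then 1 else 0)

/-- A group generated by invertible matrices that preserve a finite spanning set of vectors is
finite. -/
theorem Subgroup.finite_closure_of_mapsTo_finite_span {ι K : Type*} [Fintype ι] [DecidableEq ι]
    [Field K] {S : Set (ι → K)} (hfin : S.Finite) (hspan : Submodule.span K S = ⊤)
    {T : Set (Matrix ι ι K)ˣ}
    (hT : ∀ u ∈ T, Set.MapsTo (fun f => (u : Matrix ι ι K).mulVec f) S S) :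
    (Subgroup.closure T : Set (Matrix ι ι K)ˣ).Finite := by
  have : Finite S := hfin
  have hmaps : ∀ u ∈ Subgroup.closure T,
      Set.MapsTo (fun f => (u : Matrix ι ι K).mulVec f) S S := by
    intro u hu
    induction hu using Subgroup.closure_induction with
    | mem u hu => exact hT u hu
    | one => intro f hf; simpa using hf
    | mul u w _ _ hu hw =>
      intro f hf
      simpa [Matrix.mulVec_mulVec] using hu (hw hf)
    | inv u _ hu =>
      have hinj : Set.InjOn (fun f => (u : Matrix ι ι K).mulVec f) S := fun f _ g _ h =>
        Matrix.mulVec_injective_of_isUnit u.isUnit h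
      intro f hf
      obtain ⟨⟨g, hg⟩, hgf⟩ := Finite.surjective_of_injective (hu.restrict_inj.mpr hinj) ⟨f, hf⟩
      obtain rfl : (u : Matrix ι ι K).mulVec g = f := congrArg Subtype.val hgf
      simpa [Matrix.mulVec_mulVec] using hg
  refine Set.Finite.of_injOn (t := Set.pi Set.univ fun _ : S => S)
    (f := fun (u : (Matrix ι ι K)ˣ) (p : S) => (u : Matrix ι ι K).mulVec p)
    (fun u hu p _ => hmaps u hu p.2) (fun u _ w _ h => ?_) (Set.Finite.pi fun _ => hfin)
  apply Units.ext
  apply Matrix.toLin'.injective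
  refine LinearMap.ext_on hspan fun f hf => ?_
  simpa using congrFun h ⟨f, hf⟩

namespace QubitRepresentation

/-- The sign `(-1)^(a b)`. -/
def sign (a b : Fin 2) : ℂ := if a = 1 ∧ b = 1 then -1 else 1

@[simp] theorem sign_zero_left (b : Fin 2) : sign 0 b = 1 := by simp [sign]

@[simp] theorem sign_zero_right (a : Fin 2) : sign a 0 = 1 := by simp [sign]

theorem sign_add_left (a b c : Fin 2) : sign (a + b) c = sign a c * sign b c := by
  fin_cases a <;> fin_cases b <;> fin_cases c <;> simp [sign]

theorem sign_add_right (a b c : Fin 2) : sign a (b + c) = sign a b * sign a c := by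
  fin_cases a <;> fin_cases b <;> fin_cases c <;> simp [sign]

theorem sign_comm (a b : Fin 2) : sign a b = sign b a := by
  simp [sign, and_comm]

theorem sign_mul_self (a b : Fin 2) : sign a b * sign a b = 1 := by
  unfold sign; split_ifs <;> simp

theorem sum_sign_mul_sign (x y : Fin 2) :
    ∑ a, sign a y * sign a x = if x = y then 2 else 0 := by
  fin_cases x <;> fin_cases y <;> norm_num [sign]

theorem prod_sign_single {ι : Type*} [Fintype ι] [DecidableEq ι] (j : ι) (t : Fin 2)
    (x : ι → Fin 2) : ∏ k, sign ((Pi.single j t : ι → Fin 2) k) (x k) = sign t (x j) := by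
  rw [Finset.prod_eq_single j] <;> simp +contextual

/-- The path-graph phase `(-1)^(∑ₖ xₖ xₖ₊₁)`. -/
def pathPhase {n : ℕ} (x : Fin (n + 1) → Fin 2) : ℂ :=
  ∏ k : Fin n, sign (x k.castSucc) (x k.succ)

/-- The graph state `v_s(x) = (-1)^(s·x + ∑ₖ xₖ xₖ₊₁)` of the path on `n + 1` vertices. -/
def graphState {n : ℕ} (s x : Fin (n + 1) → Fin 2) : ℂ :=
  (∏ k, sign (s k) (x k)) * pathPhase x

theorem pathPhase_mul_self {n : ℕ} (x : Fin (n + 1) → Fin 2) :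
    pathPhase x * pathPhase x = 1 := by
  simp [pathPhase, ← Finset.prod_mul_distrib, sign_mul_self]

theorem graphState_add_single_left {n : ℕ} (s x : Fin (n + 1) → Fin 2) (j : Fin (n + 1))
    (t : Fin 2) : graphState (s + Pi.single j t) x = sign t (x j) * graphState s x := by
  simp only [graphState, Pi.add_apply, sign_add_left, Finset.prod_mul_distrib, prod_sign_single]
  ring

theorem pathPhase_add_single {n : ℕ} (x : Fin (n + 1) → Fin 2) (i : ℕ) (hi : i + 2 < n + 1)
    (t : Fin 2) :
    pathPhase (x + Pi.single ⟨i + 1, by omega⟩ t) =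
      sign t (x ⟨i, by omega⟩ + x ⟨i + 2, hi⟩) * pathPhase x := by
  have hfactor : ∀ k : Fin n,
      sign ((x + Pi.single ⟨i + 1, by omega⟩ t : Fin (n + 1) → Fin 2) k.castSucc)
        ((x + Pi.single ⟨i + 1, by omega⟩ t : Fin (n + 1) → Fin 2) k.succ) =
      (if k = ⟨i, by omega⟩ then sign t (x ⟨i, by omega⟩) else 1) *
        (if k = ⟨i + 1, by omega⟩ then sign t (x ⟨i + 2, hi⟩) else 1) *
        sign (x k.castSucc) (x k.succ) := by
    rintro ⟨k, hk⟩
    by_cases h1 : k = i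
    · subst h1
      simp [sign_add_right, sign_comm _ t, mul_comm]
      ring
    · by_cases h2 : k = i + 1
      · subst h2
        simp [sign_add_left, mul_comm]
      · simp [h1, h2]
  simp only [pathPhase, hfactor, Finset.prod_mul_distrib, Finset.prod_ite_eq', Finset.mem_univ,
    if_true, sign_add_right]

theorem graphState_add_single_right {n : ℕ} (s x : Fin (n + 1) → Fin 2) (i : ℕ)
    (hi : i + 2 < n + 1) (t : Fin 2) :
    graphState s (x + Pi.single ⟨i + 1, by omega⟩ t) =
      sign t (s ⟨i + 1, by omega⟩ + (x ⟨i, by omega⟩ + x ⟨i + 2, hi⟩)) * graphState s x := by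
  have hprod : ∏ k, sign (s k) ((Pi.single ⟨i + 1, by omega⟩ t : Fin (n + 1) → Fin 2) k) =
      sign t (s ⟨i + 1, by omega⟩) := by
    simp only [sign_comm (s _)]
    exact prod_sign_single _ _ _
  simp only [graphState, pathPhase_add_single x i hi, Pi.add_apply, sign_add_right,
    Finset.prod_mul_distrib, hprod]
  ring

theorem sum_sign_smul_graphState {n : ℕ} (y : Fin (n + 1) → Fin 2) :
    ∑ s, (∏ k, sign (s k) (y k)) • graphState s =
      (2 ^ (n + 1) * pathPhase y) • (Pi.single y 1 : (Fin (n + 1) → Fin 2) → ℂ) := by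
  ext x
  have horth : ∑ s : Fin (n + 1) → Fin 2, ∏ k, sign (s k) (y k) * sign (s k) (x k) =
      if x = y then 2 ^ (n + 1) else 0 := by
    have h := Finset.prod_univ_sum (fun _ : Fin (n + 1) => (Finset.univ : Finset (Fin 2)))
      (fun k a => sign a (y k) * sign a (x k))
    rw [Fintype.piFinset_univ] at h
    rw [← h]
    simp only [sum_sign_mul_sign]
    split_ifs with hxy
    · simp [hxy]
    · obtain ⟨k, hk⟩ := Function.ne_iff.mp hxy
      exact Finset.prod_eq_zero (Finset.mem_univ k) (if_neg hk)
  simp only [Finset.sum_apply, Pi.smul_apply, smul_eq_mul, graphState, ← mul_assoc,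
    ← Finset.prod_mul_distrib, ← Finset.sum_mul, horth, Pi.single_apply]
  split_ifs with hxy <;> simp [hxy]

theorem span_range_graphState (n : ℕ) :
    Submodule.span ℂ (Set.range (graphState (n := n))) = ⊤ := by
  rw [eq_top_iff, ← (Pi.basisFun ℂ (Fin (n + 1) → Fin 2)).span_eq, Submodule.span_le]
  rintro _ ⟨y, rfl⟩
  have hc : (2 ^ (n + 1) * pathPhase y : ℂ) ≠ 0 :=
    mul_ne_zero (pow_ne_zero _ two_ne_zero) (left_ne_zero_of_mul_eq_one (pathPhase_mul_self y))
  rw [Pi.basisFun_apply, SetLike.mem_coe, ← Submodule.smul_mem_iff _ hc,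
    ← sum_sign_smul_graphState]
  exact Submodule.sum_mem _ fun s _ => Submodule.smul_mem _ _ (Submodule.subset_span ⟨s, rfl⟩)

theorem RY_apply (m : ℕ) (a b c a' b' c' : Fin 2) :
    RY m (a, b, c) (a', b', c') =
      if a = a' ∧ c = c' then
        if b = b' + (a + c) then (Real.cos (Real.pi / m) : ℂ)
        else Complex.I * (Real.sin (Real.pi / m) : ℂ) * sign 1 (a + c)
      else 0 := by
  fin_cases a <;> fin_cases b <;> fin_cases c <;> fin_cases a' <;> fin_cases b' <;>
    fin_cases c' <;>
    simp [RY, NOTgate, ZXZ, pauliX, pauliZ, sign, Matrix.mul_apply, Matrix.one_apply]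

/-- The eigenvalue `exp(±iπ/m)` of `exp((iπ/m) Z ⊗ X ⊗ Z)` attached to the sign `(-1)^s`. -/
noncomputable def eigenphase (m : ℕ) (s : Fin 2) : ℂ :=
  (Real.cos (Real.pi / m) : ℂ) + Complex.I * (Real.sin (Real.pi / m) : ℂ) * sign 1 s

theorem eigenphase_pow (m : ℕ) (hm : m ≠ 0) (s : Fin 2) : eigenphase m s ^ (2 * m) = 1 := by
  have hm' : (m : ℂ) ≠ 0 := by exact_mod_cast hm
  have hexp : eigenphase m s = Complex.exp ((Real.pi / m * sign 1 s : ℂ) * Complex.I) := by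
    rw [Complex.exp_mul_I, eigenphase]
    fin_cases s <;> simp [sign] <;> ring
  rw [hexp, ← Complex.exp_nat_mul]
  have harg : ((2 * m : ℕ) : ℂ) * ((Real.pi / m * sign 1 s : ℂ) * Complex.I) =
      sign 1 s * (2 * Real.pi * Complex.I) := by
    push_cast; field_simp
  rw [harg]
  fin_cases s
  · simp [sign, Complex.exp_two_pi_mul_I]
  · simp [sign, Complex.exp_neg, Complex.exp_two_pi_mul_I]

theorem sum_RY_mul_sign (m : ℕ) (a b c s : Fin 2) :
    ∑ t, RY m (a, b, c) (a, b + t, c) * sign t (s + (a + c)) =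
      eigenphase m s * (sign (s + 1) c * sign (s + 1) a) := by
  simp only [RY_apply, eigenphase]
  fin_cases a <;> fin_cases b <;> fin_cases c <;> fin_cases s <;> simp [sign] <;> ring

theorem rhoGen_mulVec_apply (m n : ℕ) (i : Fin (n - 1)) (f : (Fin (n + 1) → Fin 2) → ℂ)
    (x : Fin (n + 1) → Fin 2) :
    (rhoGen m n i).mulVec f x =
      ∑ t, RY m (x ⟨i, by omega⟩, x ⟨i + 1, by omega⟩, x ⟨i + 2, by omega⟩)
          (x ⟨i, by omega⟩, x ⟨i + 1, by omega⟩ + t, x ⟨i + 2, by omega⟩) *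
        f (x + Pi.single ⟨i + 1, by omega⟩ t) := by
  symm
  refine Fintype.sum_of_injective
    (fun t => x + (Pi.single ⟨i + 1, by omega⟩ t : Fin (n + 1) → Fin 2)) ?_ _ _ ?_ ?_
  · exact (add_right_injective x).comp (Pi.single_injective _)
  · intro y hy
    rw [mul_eq_zero]
    left
    by_contra hne
    simp only [rhoGen, RY_apply] at hne
    obtain ⟨hRY, hprod⟩ := mul_ne_zero_iff.mp hne
    have hends := (ite_ne_right_iff.mp hRY).1
    refine hy ⟨y ⟨i + 1, by omega⟩ - x ⟨i + 1, by omega⟩, funext fun k => ?_⟩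
    by_cases hk : k = ⟨i + 1, by omega⟩
    · subst hk; simp
    have hxy : x k = y k := by
      by_cases h0 : (k : ℕ) = i
      · have : k = ⟨i, by omega⟩ := Fin.ext h0
        rw [this]; exact hends.1
      by_cases h2 : (k : ℕ) = i + 2
      · have : k = ⟨i + 2, by omega⟩ := Fin.ext h2
        rw [this]; exact hends.2
      have h1 : (k : ℕ) ≠ i + 1 := fun h => hk (Fin.ext h)
      have := Finset.prod_ne_zero_iff.mp hprod k (by simp [h0, h1, h2])
      exact (ite_ne_right_iff.mp this).1
    simp [hk, hxy]
  · intro t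
    have hprod : ∏ k ∈ Finset.univ.filter (fun k : Fin (n + 1) =>
        (k : ℕ) ≠ i ∧ (k : ℕ) ≠ (i : ℕ) + 1 ∧ (k : ℕ) ≠ (i : ℕ) + 2),
        (if x k = (x + Pi.single ⟨i + 1, by omega⟩ t : Fin (n + 1) → Fin 2) k
          then (1 : ℂ) else 0) = 1 := by
      refine Finset.prod_eq_one fun k hk => if_pos ?_
      have h1 : k ≠ ⟨i + 1, by omega⟩ := fun h => (Finset.mem_filter.mp hk).2.2.1 (by simp [h])
      simp [h1]
    simp only [rhoGen, hprod]
    simp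

/-- Each braid generator permutes the graph states up to a phase. -/
theorem rhoGen_mulVec_graphState (m n : ℕ) (i : Fin (n - 1)) (s : Fin (n + 1) → Fin 2) :
    (rhoGen m n i).mulVec (graphState s) =
      eigenphase m (s ⟨i + 1, by omega⟩) •
        graphState (s + Pi.single ⟨i, by omega⟩ (s ⟨i + 1, by omega⟩ + 1) +
          Pi.single ⟨i + 2, by omega⟩ (s ⟨i + 1, by omega⟩ + 1)) := by
  ext x
  have hi : (i : ℕ) + 2 < n + 1 := by omega
  simp only [rhoGen_mulVec_apply, graphState_add_single_right s x i hi, ← mul_assoc,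
    ← Finset.sum_mul, sum_RY_mul_sign, Pi.smul_apply, smul_eq_mul, graphState_add_single_left]

end QubitRepresentation

open QubitRepresentation in
/-- The image of the `n`-strand braid group under the qubit representation
`ρ_{R_{Y₁}}` is finite: the subgroup of the invertible linear maps of
`(ℂ²)^{⊗(n+1)}` generated by `ρ(σ₁), …, ρ(σ_{n-1})` is a finite group. -/
theorem qubit_representation_image_finite (m : ℕ) (hm : 5 ≤ m) (hodd : Odd m)
    (n : ℕ) (hn : 2 ≤ n) :
    (Subgroup.closure {u : (Matrix (Fin (n + 1) → Fin 2) (Fin (n + 1) → Fin 2) ℂ)ˣ |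
        ∃ i : Fin (n - 1),
          (u : Matrix (Fin (n + 1) → Fin 2) (Fin (n + 1) → Fin 2) ℂ) = rhoGen m n i} :
      Set (Matrix (Fin (n + 1) → Fin 2) (Fin (n + 1) → Fin 2) ℂ)ˣ).Finite := by
  have hm0 : m ≠ 0 := by omega
  have hroots : {z : ℂ | z ^ (2 * m) = 1}.Finite := by
    refine (Polynomial.nthRootsFinset (2 * m) (1 : ℂ)).finite_toSet.subset fun z hz => ?_
    simpa [Polynomial.mem_nthRootsFinset (show 0 < 2 * m by omega)] using hz
  refine Subgroup.finite_closure_of_mapsTo_finite_span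
    (S := Set.image2 (· • ·) {z : ℂ | z ^ (2 * m) = 1} (Set.range (graphState (n := n))))
    (hroots.image2 _ (Set.finite_range _)) ?_ ?_
  · rw [eq_top_iff, ← span_range_graphState n]
    exact Submodule.span_mono fun f hf => ⟨1, one_pow _, f, hf, one_smul _ _⟩
  · rintro u ⟨i, hu⟩ _ ⟨z, hz, _, ⟨s, rfl⟩, rfl⟩
    refine ⟨z * eigenphase m (s ⟨i + 1, by omega⟩), ?_, _, Set.mem_range_self
      (s + Pi.single ⟨i, by omega⟩ (s ⟨i + 1, by omega⟩ + 1) +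
        Pi.single ⟨i + 2, by omega⟩ (s ⟨i + 1, by omega⟩ + 1)), ?_⟩
    · rw [Set.mem_ofPred_eq, mul_pow, hz, eigenphase_pow m hm0, one_mul]
    · simp only [hu, Matrix.mulVec_smul, rhoGen_mulVec_graphState, smul_smul]
end
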